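/- Let A be a noetherian local almost Cohen-Macaulay ring, P a prime of A, and Q an associated prime of Â/PÂ (where Â is the m-adic completion). Then Â_Q/PÂ_Q is almost Cohen-Macaulay. -/

import Mathlib

open IsLocalRing

/-- The `I`-depth (grade) of an `A`-module `M`: the supremum of lengths of
`M`-regular sequences with entries in `I`. -/
noncomputable def idealDepth {A : Type*} [CommRing A] (I : Ideal A)
    (M : Type*) [AddCommGroup M] [Module A M] : ℕ∞ :=
  sSup {n : ℕ∞ | ∃ rs : List A, (rs.length : ℕ∞) = n ∧ (∀ r ∈ rs, r ∈ I) ∧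
    RingTheory.Sequence.IsRegular M rs}

/-- The depth of a local ring: the depth with respect to its maximal ideal. -/
noncomputable def ringDepth (A : Type*) [CommRing A] [IsLocalRing A] : ℕ∞ :=
  idealDepth (IsLocalRing.maximalIdeal A) A

/-- depth(A_P), the depth of the localization of `A` at the prime `P`. -/
noncomputable def localDepth {A : Type*} [CommRing A] (P : Ideal A) [P.IsPrime] : ℕ∞ :=
  ringDepth (Localization.AtPrime P)

/-- The height of a prime ideal. -/
noncomputable def primeHeight {A : Type*} [CommRing A] (P : Ideal A) [P.IsPrime] : ℕ∞ :=
  Order.height (⟨P, inferInstance⟩ : PrimeSpectrum A)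

/-- A noetherian local ring is almost Cohen-Macaulay if `dim A ≤ 1 + depth A`. -/
def IsAlmostCM (A : Type*) [CommRing A] [IsLocalRing A] : Prop :=
  ringKrullDim A ≤ ((1 + ringDepth A : ℕ∞) : WithBot ℕ∞)

/-- Almost Cohen-Macaulay for a (local) ring presented with an explicit maximal ideal `I`:
`dim R ≤ 1 + depth_I R`. -/
def IsAlmostCMWith (R : Type*) [CommRing R] (I : Ideal R) : Prop :=
  ringKrullDim R ≤ ((1 + idealDepth I R : ℕ∞) : WithBot ℕ∞)

/-- A ring is almost Cohen-Macaulay (Han/Kang) if `depth_P A = depth (A_P)` for all primes. -/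
def IsACM (A : Type*) [CommRing A] : Prop :=
  ∀ (P : Ideal A) [P.IsPrime], idealDepth P A = localDepth P

/-- Serre's condition `(S_k)`: `depth A_P ≥ min (ht P, k)` for all primes `P`. -/
def SerreCond (k : ℕ) (A : Type*) [CommRing A] : Prop :=
  ∀ (P : Ideal A) [P.IsPrime], min (primeHeight P) (k : ℕ∞) ≤ localDepth P

/-- The condition `(C_k)`: `depth A_P ≥ min (ht P, k) - 1` for all primes `P`. -/
def CondC (k : ℕ) (A : Type*) [CommRing A] : Prop :=
  ∀ (P : Ideal A) [P.IsPrime], min (primeHeight P) (k : ℕ∞) ≤ 1 + localDepth P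

section RegularSequences

open RingTheory.Sequence CategoryTheory CategoryTheory.Abelian Pointwise

universe u

theorem Ideal.smul_top_lt_top_of_le_maximalIdeal {R : Type*} [CommRing R] [IsLocalRing R]
    {I : Ideal R} (hI : I ≤ maximalIdeal R) (M : Type*) [AddCommGroup M] [Module R M]
    [Module.Finite R M] [Nontrivial M] :
    I • (⊤ : Submodule R M) < ⊤ := by
  refine lt_of_le_of_lt (Submodule.smul_mono_left hI) (Ne.lt_top ?_)
  exact (Submodule.top_ne_ideal_smul_of_le_jacobson_annihilator
    (IsLocalRing.maximalIdeal_le_jacobson _)).symm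

variable {R : Type u} [CommRing R] [IsNoetherianRing R] [IsLocalRing R]

theorem exists_isRegular_quotSMulTop {I : Ideal R} (hI : I ≤ maximalIdeal R)
    {M : Type u} [AddCommGroup M] [Module R M] [Module.Finite R M] {z : R} (hz : z ∈ I)
    (hzM : IsSMulRegular M z) {n : ℕ}
    (h : ∃ rs : List R, rs.length = n + 1 ∧ (∀ r ∈ rs, r ∈ I) ∧ IsRegular M rs) :
    ∃ rs : List R, rs.length = n ∧ (∀ r ∈ rs, r ∈ I) ∧ IsRegular (QuotSMulTop z M) rs := by
  have : Nontrivial M := by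
    obtain ⟨rs, -, -, hrs⟩ := h
    exact hrs.nontrivial
  have : Nontrivial (QuotSMulTop z M) := nontrivial_quotSMulTop_of_mem_maximalIdeal M (hI hz)
  have hM := (ModuleCat.exists_isRegular_tfae I (n + 1) (ModuleCat.of R M)
    (I.smul_top_lt_top_of_le_maximalIdeal hI M)).out 1 3
  have hQ := (ModuleCat.exists_isRegular_tfae I n (ModuleCat.of R (QuotSMulTop z M))
    (I.smul_top_lt_top_of_le_maximalIdeal hI _)).out 1 3
  have hExt := hM.mpr h
  refine hQ.mp fun i hi ↦ ?_
  have hzM' : IsSMulRegular (ModuleCat.of R M) z := hzM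
  have zero1 := AddCommGrpCat.isZero_of_iff_subsingleton.mpr (hExt i (by omega))
  have zero2 := AddCommGrpCat.isZero_of_iff_subsingleton.mpr (hExt (i + 1) (by omega))
  exact AddCommGrpCat.subsingleton_of_isZero <| ShortComplex.Exact.isZero_of_both_zeros
    ((Ext.covariant_sequence_exact₃' _ hzM'.smulShortComplex_shortExact) i (i + 1) rfl)
    (zero1.eq_zero_of_src _) (zero2.eq_zero_of_tgt _)

theorem exists_isRegular_quot_ofList {I : Ideal R} (hI : I ≤ maximalIdeal R)
    {M : Type u} [AddCommGroup M] [Module R M] [Module.Finite R M] {ys rs : List R}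
    (hysI : ∀ r ∈ ys, r ∈ I) (hys : IsRegular M ys)
    (hrsI : ∀ r ∈ rs, r ∈ I) (hrs : IsRegular M rs) :
    ∃ rs' : List R, rs.length ≤ rs'.length + ys.length ∧ (∀ r ∈ rs', r ∈ I) ∧
      IsRegular (M ⧸ Ideal.ofList ys • (⊤ : Submodule R M)) rs' := by
  induction ys generalizing M rs with
  | nil =>
    refine ⟨rs, by simp, hrsI, ?_⟩
    exact ((Submodule.quotEquivOfEqBot _ (by simp)).isRegular_congr rs).mpr hrs
  | cons y ys ih =>
    rw [isRegular_cons_iff] at hys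
    have hy := hysI y List.mem_cons_self
    have hys' : ∀ r ∈ ys, r ∈ I := fun r hr ↦ hysI r (List.mem_cons_of_mem _ hr)
    obtain ⟨ts, hlen, htsI, hts⟩ : ∃ ts : List R, rs.length ≤ ts.length + 1 ∧
        (∀ r ∈ ts, r ∈ I) ∧ IsRegular (QuotSMulTop y M) ts := by
      rcases h : rs.length with _ | n
      · have := hys.2.nontrivial
        exact ⟨[], by simp, by simp, IsRegular.nil R _⟩
      · obtain ⟨ts, h1, h2, h3⟩ := exists_isRegular_quotSMulTop hI hy hys.1 ⟨rs, h, hrsI, hrs⟩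
        exact ⟨ts, by omega, h2, h3⟩
    obtain ⟨rs', h1, h2, h3⟩ := ih hys' hys.2 htsI hts
    refine ⟨rs', by simp; omega, h2, ?_⟩
    exact ((Submodule.quotOfListConsSMulTopEquivQuotSMulTopInner M y ys).isRegular_congr rs').mpr h3

theorem length_le_coheight_of_isAssociatedPrime {M : Type u} [AddCommGroup M] [Module R M]
    [Module.Finite R M] {rs : List R} (hrsm : ∀ r ∈ rs, r ∈ maximalIdeal R)
    (hrs : IsRegular M rs) (p : PrimeSpectrum R) (hp : IsAssociatedPrime p.asIdeal M) :
    (rs.length : ℕ∞) ≤ Order.coheight p := by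
  induction rs generalizing M p with
  | nil => simp
  | cons x rs ih =>
    rw [isRegular_cons_iff] at hrs
    have hx := hrsm x List.mem_cons_self
    have hrs' : ∀ r ∈ rs, r ∈ maximalIdeal R := fun r hr ↦ hrsm r (List.mem_cons_of_mem _ hr)
    obtain ⟨-, w, hw⟩ := isAssociatedPrime_iff.mp hp
    have hmem (a : R) : a ∈ p.asIdeal ↔ a • w = 0 := by
      rw [hw, Submodule.mem_colon_singleton, Submodule.mem_bot]
    have hw0 : w ≠ 0 := by
      rintro rfl
      exact p.2.ne_top ((Ideal.eq_top_iff_one _).mpr ((hmem 1).mpr (smul_zero _)))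
    have hxp : x ∉ p.asIdeal := fun h ↦ hw0 (hrs.1 (by simpa using (hmem x).mp h))
    let N : Submodule R M := Submodule.torsionBySet R M (p.asIdeal : Set R)
    have hN (v : M) : v ∈ N ↔ ∀ a ∈ p.asIdeal, a • v = 0 := by
      simp [N, Submodule.mem_torsionBySet_iff]
    obtain ⟨v, hvN, hvx⟩ : ∃ v ∈ N, v ∉ x • (⊤ : Submodule R M) := by
      by_contra! hcon
      have hle : N ≤ maximalIdeal R • N := by
        intro v hv
        obtain ⟨v', -, rfl⟩ := hcon v hv
        refine Submodule.smul_mem_smul hx ((hN v').mpr fun a ha ↦ hrs.1 ?_)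
        simpa [smul_comm x a v'] using (hN _).mp hv a ha
      have hbot : N = ⊥ := Submodule.eq_bot_of_le_smul_of_le_jacobson_bot _ N
        (IsNoetherian.noetherian N) hle (IsLocalRing.maximalIdeal_le_jacobson _)
      exact hw0 ((Submodule.mem_bot R).mp (hbot ▸ (hN w).mpr fun a ha ↦ (hmem a).mp ha))
    have hv0 : (Submodule.Quotient.mk v : QuotSMulTop x M) ≠ 0 := by
      rwa [Ne, Submodule.Quotient.mk_eq_zero]
    obtain ⟨q, hq, hle⟩ := exists_le_isAssociatedPrime_of_isNoetherianRing R _ hv0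
    have hpq : p < ⟨q, hq.isPrime⟩ := by
      refine lt_of_le_not_ge (fun a ha ↦ hle ?_) fun h ↦ hxp (h (hle ?_))
      · rw [Submodule.mem_colon_singleton, Submodule.mem_bot, ← Submodule.Quotient.mk_smul,
          (hN v).mp hvN a ha, Submodule.Quotient.mk_zero]
      · rw [Submodule.mem_colon_singleton, Submodule.mem_bot, ← Submodule.Quotient.mk_smul,
          Submodule.Quotient.mk_eq_zero]
        exact Submodule.smul_mem_pointwise_smul _ _ _ trivial
    calc ((x :: rs).length : ℕ∞) = rs.length + 1 := by simp
      _ ≤ Order.coheight (⟨q, hq.isPrime⟩ : PrimeSpectrum R) + 1 := by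
        gcongr
        exact ih hrs' hrs.2 _ hq
      _ ≤ _ := Order.coheight_add_one_le hpq

theorem length_le_of_smul_mem_ofList_smul_top {I : Ideal R} (hI : I ≤ maximalIdeal R)
    {M : Type u} [AddCommGroup M] [Module R M] [Module.Finite R M] {ys rs : List R}
    (hysI : ∀ r ∈ ys, r ∈ I) (hys : IsRegular M ys)
    {u : M} (hu : u ∉ Ideal.ofList ys • (⊤ : Submodule R M))
    (hIu : ∀ r ∈ I, r • u ∈ Ideal.ofList ys • (⊤ : Submodule R M))
    (hrsI : ∀ r ∈ rs, r ∈ I) (hrs : IsRegular M rs) : rs.length ≤ ys.length := by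
  obtain ⟨rs', hlen, hrs'I, hrs'⟩ := exists_isRegular_quot_ofList hI hysI hys hrsI hrs
  rcases rs' with _ | ⟨x, rs'⟩
  · simpa using hlen
  · rw [isRegular_cons_iff] at hrs'
    refine absurd ?_ hu
    rw [← Submodule.Quotient.mk_eq_zero]
    refine hrs'.1 ?_
    simpa [← Submodule.Quotient.mk_smul, Submodule.Quotient.mk_eq_zero] using
      hIu x (hrs'I x List.mem_cons_self)

theorem length_le_coheight_add_length {M : Type u} [AddCommGroup M] [Module R M]
    [Module.Finite R M] (q : PrimeSpectrum R) {ys rs : List R}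
    (hysq : ∀ r ∈ ys, r ∈ q.asIdeal) (hys : IsRegular M ys)
    {u : M} (hu : u ∉ Ideal.ofList ys • (⊤ : Submodule R M))
    (hqu : ∀ r ∈ q.asIdeal, r • u ∈ Ideal.ofList ys • (⊤ : Submodule R M))
    (hrsm : ∀ r ∈ rs, r ∈ maximalIdeal R) (hrs : IsRegular M rs) :
    (rs.length : ℕ∞) ≤ Order.coheight q + ys.length := by
  have hle := IsLocalRing.le_maximalIdeal q.2.ne_top
  obtain ⟨rs', hlen, hrs'm, hrs'⟩ :=
    exists_isRegular_quot_ofList le_rfl (fun r hr ↦ hle (hysq r hr)) hys hrsm hrs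
  have hu0 : (Submodule.Quotient.mk u : M ⧸ Ideal.ofList ys • (⊤ : Submodule R M)) ≠ 0 := by
    rwa [Ne, Submodule.Quotient.mk_eq_zero]
  obtain ⟨p, hp, hup⟩ := exists_le_isAssociatedPrime_of_isNoetherianRing R _ hu0
  have hqp : q ≤ ⟨p, hp.isPrime⟩ := fun a ha ↦ hup <| by
    rw [Submodule.mem_colon_singleton, Submodule.mem_bot, ← Submodule.Quotient.mk_smul,
      Submodule.Quotient.mk_eq_zero]
    exact hqu a ha
  calc (rs.length : ℕ∞) ≤ rs'.length + ys.length := by exact_mod_cast hlen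
    _ ≤ _ := by
      gcongr
      exact (length_le_coheight_of_isAssociatedPrime hrs'm hrs' ⟨p, hp.isPrime⟩ hp).trans
        (Order.coheight_anti hqp)

theorem exists_isRegular_smul_mem_ofList_smul_top {I : Ideal R} (hI : I ≤ maximalIdeal R)
    {M : Type u} [AddCommGroup M] [Module R M] [Module.Finite R M] [Nontrivial M] (n : ℕ)
    (hn : ∀ rs : List R, (∀ r ∈ rs, r ∈ I) → IsRegular M rs → rs.length ≤ n) :
    ∃ ys : List R, (∀ r ∈ ys, r ∈ I) ∧ IsRegular M ys ∧
      ∃ u : M, u ∉ Ideal.ofList ys • (⊤ : Submodule R M) ∧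
        ∀ r ∈ I, r • u ∈ Ideal.ofList ys • (⊤ : Submodule R M) := by
  let S : Set ℕ := {k | ∃ ys : List R, ys.length = k ∧ (∀ r ∈ ys, r ∈ I) ∧ IsRegular M ys}
  have hS : S.Nonempty := ⟨0, [], rfl, by simp, IsRegular.nil R M⟩
  have hbdd : BddAbove S := ⟨n, by rintro _ ⟨ys, rfl, h1, h2⟩; exact hn ys h1 h2⟩
  obtain ⟨ys, hlen, hysI, hys⟩ := Nat.sSup_mem hS hbdd
  refine ⟨ys, hysI, hys, ?_⟩
  by_contra! hcon
  let N := M ⧸ Ideal.ofList ys • (⊤ : Submodule R M)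
  have hsub : Subsingleton (R ⧸ I →ₗ[R] N) := by
    refine ⟨fun f g ↦ ?_⟩
    suffices h : ∀ f : R ⧸ I →ₗ[R] N, f = 0 by rw [h f, h g]
    intro f
    obtain ⟨u, hu⟩ := Submodule.Quotient.mk_surjective _ (f (Submodule.Quotient.mk 1))
    have hf1 : f (Submodule.Quotient.mk 1) = 0 := by
      rw [← hu, Submodule.Quotient.mk_eq_zero]
      by_contra hu'
      obtain ⟨r, hr, hru⟩ := hcon u hu'
      refine hru ?_
      rw [← Submodule.Quotient.mk_eq_zero, Submodule.Quotient.mk_smul, hu, ← map_smul,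
        ← Submodule.Quotient.mk_smul, (Submodule.Quotient.mk_eq_zero I).mpr (by simpa using hr),
        map_zero]
    ext
    simpa using hf1
  obtain ⟨r, hrI, hr⟩ := IsSMulRegular.subsingleton_linearMap_iff.mp hsub
  rw [Ideal.annihilator_quotient] at hrI
  have hmem : ∀ s ∈ ys ++ [r], s ∈ I := by
    simp only [List.mem_append, List.mem_singleton]
    rintro s (hs | rfl)
    exacts [hysI s hs, hrI]
  have hreg : IsRegular M (ys ++ [r]) := by
    rw [IsLocalRing.isRegular_iff_isWeaklyRegular_of_subset_maximalIdeal
      (fun s hs ↦ hI (hmem s hs)), isWeaklyRegular_append_iff, isWeaklyRegular_singleton_iff]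
    exact ⟨hys.toIsWeaklyRegular, hr⟩
  have := le_csSup hbdd (show ys.length + 1 ∈ S from ⟨_, by simp, hmem, hreg⟩)
  omega

end RegularSequences

section AdicNoetherian

theorem IsPrecomplete.of_surjective {R : Type*} [CommRing R] (I : Ideal R) {M N : Type*}
    [AddCommGroup M] [Module R M] [AddCommGroup N] [Module R N] [IsPrecomplete I M]
    (f : M →ₗ[R] N) (hf : Function.Surjective f) : IsPrecomplete I N := by
  refine AdicCompletion.of_surjective_iff.mp fun y ↦ ?_
  obtain ⟨x, rfl⟩ := AdicCompletion.map_surjective I hf y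
  obtain ⟨x, rfl⟩ := AdicCompletion.of_surjective I M x
  exact ⟨f x, (AdicCompletion.map_of I f x).symm⟩

theorem IsPrecomplete.idealQuotient {R S : Type*} [CommRing R] (I : Ideal R) [CommRing S]
    [Algebra R S] [IsPrecomplete I S] (J : Ideal S) : IsPrecomplete I (S ⧸ J) :=
  IsPrecomplete.of_surjective I (Ideal.Quotient.mkₐ R J).toLinearMap
    (Ideal.Quotient.mkₐ_surjective R J)

theorem IsHausdorff.of_injective {R : Type*} [CommRing R] (I : Ideal R) {M N : Type*}
    [AddCommGroup M] [Module R M] [AddCommGroup N] [Module R N] [IsHausdorff I N]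
    (f : M →ₗ[R] N) (hf : Function.Injective f) : IsHausdorff I M := by
  refine ⟨fun x hx ↦ hf ?_⟩
  rw [map_zero]
  refine IsHausdorff.haus ‹IsHausdorff I N› _ fun n ↦ ?_
  have hxn := SModEq.zero.mp (hx n)
  refine SModEq.zero.mpr (Submodule.smul_mono le_rfl
    (le_top (a := Submodule.map f ⊤)) ?_)
  rw [← Submodule.map_smul'']
  exact Submodule.mem_map_of_mem hxn

theorem IsPrecomplete.pi_fin {R : Type*} [CommRing R] (I : Ideal R) [IsPrecomplete I R] (n : ℕ) :
    IsPrecomplete I (Fin n → R) := by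
  refine AdicCompletion.of_surjective_iff.mp fun y ↦ ?_
  choose x hx using fun j ↦ AdicCompletion.of_surjective I R (AdicCompletion.piEquivFin I n y j)
  refine ⟨x, (AdicCompletion.piEquivFin I n).injective ?_⟩
  ext1 j
  rw [← hx j, AdicCompletion.piEquivFin_apply]
  rfl

theorem Module.Finite.of_isHausdorff_of_finite_quotient {R : Type*} [CommRing R] (I : Ideal R)
    [IsPrecomplete I R] (N : Type*) [AddCommGroup N] [Module R N] [IsHausdorff I N]
    [Module.Finite R (N ⧸ (I • ⊤ : Submodule R N))] : Module.Finite R N := by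
  obtain ⟨n, f, hf⟩ := Module.Finite.exists_fin' R (N ⧸ (I • ⊤ : Submodule R N))
  obtain ⟨g, hg⟩ := Module.projective_lifting_property (Submodule.mkQ (I • ⊤ : Submodule R N)) f
    (Submodule.mkQ_surjective _)
  have := IsPrecomplete.pi_fin I n
  refine Module.Finite.of_surjective g (surjective_of_mkQ_comp_surjective (I := I) ?_)
  rwa [hg]

theorem IsNoetherianRing.of_isAdicComplete_of_quotient_span_singleton {R : Type*} [CommRing R]
    (I : Ideal R) [IsAdicComplete I R] {x : R} (hx : x ∈ I)
    [IsNoetherianRing (R ⧸ Ideal.span {x})] : IsNoetherianRing R := by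
  have hnoeth : IsNoetherian R (R ⧸ Ideal.span {x}) := by
    refine ⟨fun N ↦ ?_⟩
    let J : Ideal (R ⧸ Ideal.span {x}) :=
      { N with
        smul_mem' := fun c m hm ↦ by
          obtain ⟨c, rfl⟩ := Ideal.Quotient.mk_surjective c
          exact N.smul_mem c hm }
    exact (IsNoetherian.noetherian J).restrictScalars_of_surjective
      (Ideal.Quotient.mk_surjective (I := Ideal.span {x}))
  refine IsNoetherianRing.of_prime fun P hP ↦ ?_
  by_cases hxP : x ∈ P
  · refine Submodule.fg_of_fg_map_of_fg_inf_ker (Submodule.mkQ (Ideal.span {x}))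
      (IsNoetherian.noetherian _) ?_
    rw [Submodule.ker_mkQ, inf_eq_right.mpr ((Ideal.span_singleton_le_iff_mem P).mpr hxP)]
    exact ⟨{x}, by simp⟩
  · have hHaus : IsHausdorff I P := IsHausdorff.of_injective I P.subtype P.subtype_injective
    let f : P →ₗ[R] R ⧸ Ideal.span {x} := Submodule.mkQ (Ideal.span {x}) ∘ₗ P.subtype
    have hker : LinearMap.ker f ≤ I • (⊤ : Submodule R P) := by
      rintro ⟨p, hp⟩ hfp
      have hpx : p ∈ Ideal.span {x} := (Submodule.Quotient.mk_eq_zero _).mp hfp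
      obtain ⟨y, rfl⟩ := Ideal.mem_span_singleton.mp hpx
      let y' : P := ⟨y, (hP.mem_or_mem hp).resolve_left hxP⟩
      exact Submodule.smul_mem_smul hx (Submodule.mem_top (x := y'))
    have : Module.Finite R (P ⧸ LinearMap.ker f) :=
      Module.Finite.equiv f.quotKerEquivRange.symm
    have : Module.Finite R (P ⧸ (I • ⊤ : Submodule R P)) :=
      Module.Finite.of_surjective (Submodule.factor hker) (Submodule.factor_surjective hker)
    have := Module.Finite.of_isHausdorff_of_finite_quotient I P
    exact Module.Finite.iff_fg.mp this

open scoped TensorProduct in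
theorem AdicCompletion.isNoetherianRing_quotient_map {A : Type*} [CommRing A] [IsNoetherianRing A]
    [IsLocalRing A] (J : Ideal A) :
    IsNoetherianRing (AdicCompletion (maximalIdeal A) A ⧸
      J.map (algebraMap A (AdicCompletion (maximalIdeal A) A))) := by
  induction J using WellFoundedGT.induction with
  | ind J ih =>
  let B := AdicCompletion (maximalIdeal A) A
  let C := B ⧸ J.map (algebraMap A B)
  by_cases hJm : maximalIdeal A ≤ J
  · have hle : maximalIdeal B ≤ J.map (algebraMap A B) :=
      AdicCompletion.maximalIdeal_eq_map.le.trans (Ideal.map_mono hJm)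
    let := Ideal.Quotient.field (maximalIdeal B)
    exact isNoetherianRing_of_surjective (B ⧸ maximalIdeal B) C
      (Ideal.Quotient.factor hle) (Ideal.Quotient.factor_surjective hle)
  obtain ⟨x, hxm, hxJ⟩ := Set.not_subset.mp hJm
  have hsup : IsNoetherianRing (B ⧸ (J ⊔ Ideal.span {x}).map (algebraMap A B)) := by
    refine ih _ (lt_of_le_of_ne le_sup_left fun h ↦ hxJ ?_)
    rw [h]
    exact Ideal.mem_sup_right (Ideal.mem_span_singleton_self x)
  have hHaus : IsHausdorff (maximalIdeal A) C := by
    have := AdicCompletion.isAdicComplete (M := A ⧸ J) (maximalIdeal A).fg_of_isNoetherianRing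
    let e : C ≃ₗ[B] AdicCompletion (maximalIdeal A) (A ⧸ J) :=
      (Algebra.TensorProduct.quotIdealMapEquivTensorQuot B J).toLinearEquiv.trans
        (AdicCompletion.ofTensorProductEquivOfFiniteNoetherian (maximalIdeal A) (A ⧸ J))
    exact IsHausdorff.of_injective _ (e.toLinearMap.restrictScalars A) e.injective
  have hPre : IsPrecomplete (maximalIdeal A) C := by
    have := AdicCompletion.isAdicComplete (M := A) (maximalIdeal A).fg_of_isNoetherianRing
    exact IsPrecomplete.idealQuotient _ _
  have : IsAdicComplete ((maximalIdeal A).map (algebraMap A C)) C :=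
    (IsAdicComplete.map_algebraMap_iff _ _).mpr { }
  have : IsNoetherianRing (C ⧸ Ideal.span {algebraMap A C x}) := by
    rw [Ideal.map_sup, Ideal.map_span, Set.image_singleton] at hsup
    have h := isNoetherianRing_of_ringEquiv _
      (DoubleQuot.quotQuotEquivQuotSup (J.map (algebraMap A B)) (Ideal.span {algebraMap A B x})).symm
    rwa [Ideal.map_span, Set.image_singleton] at h
  exact IsNoetherianRing.of_isAdicComplete_of_quotient_span_singleton
    ((maximalIdeal A).map (algebraMap A C)) (Ideal.mem_map_of_mem _ hxm)

instance AdicCompletion.isNoetherianRing_of_isLocalRing {A : Type*} [CommRing A]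
    [IsNoetherianRing A] [IsLocalRing A] :
    IsNoetherianRing (AdicCompletion (maximalIdeal A) A) := by
  have := AdicCompletion.isNoetherianRing_quotient_map (⊥ : Ideal A)
  rw [Ideal.map_bot] at this
  exact isNoetherianRing_of_ringEquiv _ (RingEquiv.quotientBot _)

end AdicNoetherian

section Flat

open scoped TensorProduct in
theorem Ideal.mul_algebraMap_mem_map_iff_of_flat {A B : Type*} [CommRing A] [CommRing B]
    [Algebra A B] [Module.Flat A B] {N P : Ideal A} {u : A} (hu : ∀ a, a * u ∈ N ↔ a ∈ P) (b : B) :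
    b * algebraMap A B u ∈ N.map (algebraMap A B) ↔ b ∈ P.map (algebraMap A B) := by
  let φ : A ⧸ P →ₗ[A] A ⧸ N := Submodule.mapQ P N (LinearMap.mulRight A u) fun a ha ↦ (hu a).mpr ha
  have hφ : Function.Injective φ := by
    rw [← LinearMap.ker_eq_bot, LinearMap.ker_eq_bot']
    intro a ha
    obtain ⟨a, rfl⟩ := Submodule.Quotient.mk_surjective _ a
    exact (Submodule.Quotient.mk_eq_zero _).mpr
      ((hu a).mp ((Submodule.Quotient.mk_eq_zero _).mp ha))
  have hB := Module.Flat.lTensor_preserves_injective_linearMap (M := B) φ hφ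
  have key (I : Ideal A) (c : B) (a : A) :
      c ⊗ₜ[A] (Submodule.Quotient.mk a : A ⧸ I) = 0 ↔
        c * algebraMap A B a ∈ I.map (algebraMap A B) := by
    rw [← (Algebra.TensorProduct.quotIdealMapEquivTensorQuot B I).symm.map_eq_zero_iff,
      ← Ideal.Quotient.eq_zero_iff_mem]
    have h := Algebra.TensorProduct.quotIdealMapEquivTensorQuot_symm_tmul B I c a
    rw [Algebra.smul_def, mul_comm] at h
    exact Eq.congr_left h
  have h1 := key P b 1
  rw [map_one, mul_one] at h1
  have hφ1 : φ (Submodule.Quotient.mk 1) = Submodule.Quotient.mk u :=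
    congrArg Submodule.Quotient.mk (one_mul u)
  rw [← h1, ← key N b u, ← map_eq_zero_iff _ hB, LinearMap.lTensor_tmul, hφ1]

open RingTheory.Sequence

universe u

theorem RingTheory.Sequence.IsRegular.length_le_height_maximalIdeal {R : Type*} [CommRing R]
    [IsNoetherianRing R] [IsLocalRing R] {rs : List R} (hrs : IsRegular R rs) :
    (rs.length : ℕ∞) ≤ (maximalIdeal R).height := by
  have : Nontrivial (R ⧸ Ideal.ofList rs) := by
    refine Ideal.Quotient.nontrivial_iff.mpr fun h ↦ hrs.2 ?_
    simp [h]
  have h := ringKrullDim_add_length_eq_ringKrullDim_of_isRegular rs hrs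
  rw [← maximalIdeal_height_eq_ringKrullDim (R := R)] at h
  have h0 : (0 : WithBot ℕ∞) ≤ ringKrullDim (R ⧸ Ideal.ofList rs) := ringKrullDim_nonneg_of_nontrivial
  have : ((rs.length : ℕ∞) : WithBot ℕ∞) ≤ ((maximalIdeal R).height : WithBot ℕ∞) := by
    rw [← h]
    exact le_add_of_nonneg_left h0
  exact WithBot.coe_le_coe.mp this

theorem exists_length_le_of_flat_of_isLocalHom {A B : Type u} [CommRing A] [CommRing B]
    [IsNoetherianRing A] [IsNoetherianRing B] [IsLocalRing A] [IsLocalRing B] [Algebra A B]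
    [Module.Flat A B] [IsLocalHom (algebraMap A B)] {v : B}
    (hv : v ∉ (maximalIdeal A).map (algebraMap A B))
    (hmv : ∀ r ∈ maximalIdeal B, r * v ∈ (maximalIdeal A).map (algebraMap A B)) :
    ∃ g : ℕ, (g : ℕ∞) ≤ (maximalIdeal A).height ∧
      ∀ zs : List B, (∀ z ∈ zs, z ∈ maximalIdeal B) → IsRegular B zs → zs.length ≤ g := by
  obtain ⟨n, hn⟩ := ENat.ne_top_iff_exists.mp
    (Ideal.height_ne_top (maximalIdeal.isMaximal A).ne_top)
  obtain ⟨ys, hysm, hys, u, hu, hmu⟩ := exists_isRegular_smul_mem_ofList_smul_top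
    (le_refl (maximalIdeal A)) (M := A) n fun rs _ hrs ↦ by
      have := hrs.length_le_height_maximalIdeal
      rw [← hn] at this
      exact_mod_cast this
  have : Module.FaithfullyFlat A B := Module.FaithfullyFlat.of_flat_of_isLocalHom
  simp only [smul_eq_mul, Ideal.mul_top] at hu hmu
  have hcolon (a : A) : a * u ∈ Ideal.ofList ys ↔ a ∈ maximalIdeal A := by
    refine ⟨fun h ↦ ?_, hmu a⟩
    by_contra ha
    exact hu ((Ideal.unit_mul_mem_iff_mem _ (by simpa using ha)).mp h)
  have hle : (maximalIdeal A).map (algebraMap A B) ≤ maximalIdeal B :=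
    ((local_hom_TFAE (algebraMap A B)).out 0 2 rfl rfl).mp inferInstance
  have key := Ideal.mul_algebraMap_mem_map_iff_of_flat (B := B) hcolon
  refine ⟨ys.length, hys.length_le_height_maximalIdeal, fun zs hzm hzs ↦ ?_⟩
  rw [← ys.length_map (algebraMap A B)]
  refine length_le_of_smul_mem_ofList_smul_top (le_refl (maximalIdeal B)) ?_ hys.of_faithfullyFlat
    (u := v * algebraMap A B u) ?_ (fun r hr ↦ ?_) hzm hzs
  · intro r hr
    obtain ⟨y, hy, rfl⟩ := List.mem_map.mp hr
    exact hle (Ideal.mem_map_of_mem _ (hysm y hy))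
  · rw [smul_eq_mul, Ideal.mul_top, ← Ideal.map_ofList, key]
    exact hv
  · rw [smul_eq_mul, smul_eq_mul, Ideal.mul_top, ← Ideal.map_ofList, ← mul_assoc, key]
    exact hmv r hr

theorem length_le_coheight_add_of_localization {R : Type u} [CommRing R] [IsNoetherianRing R]
    [IsLocalRing R] (q : PrimeSpectrum R) {g : ℕ}
    (hg : ∀ zs : List (Localization.AtPrime q.asIdeal), (∀ z ∈ zs, z ∈ maximalIdeal _) →
      IsRegular (Localization.AtPrime q.asIdeal) zs → zs.length ≤ g)
    {rs : List R} (hrsm : ∀ r ∈ rs, r ∈ maximalIdeal R) (hrs : IsRegular R rs) :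
    (rs.length : ℕ∞) ≤ Order.coheight q + g := by
  have hbound (zs : List R) (hzq : ∀ z ∈ zs, z ∈ q.asIdeal) (hzs : IsRegular R zs) :
      zs.length ≤ g := by
    rw [← zs.length_map (algebraMap R (Localization.AtPrime q.asIdeal))]
    refine hg _ ?_ (hzs.toIsWeaklyRegular.isRegular_of_isLocalization_of_mem _ q.asIdeal hzq)
    intro z hz
    obtain ⟨y, hy, rfl⟩ := List.mem_map.mp hz
    exact (IsLocalization.AtPrime.to_map_mem_maximal_iff _ q.asIdeal y).mpr (hzq y hy)
  obtain ⟨ys, hysq, hys, u, hu, hqu⟩ := exists_isRegular_smul_mem_ofList_smul_top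
    (le_maximalIdeal q.2.ne_top) (M := R) g hbound
  refine (length_le_coheight_add_length q hysq hys hu hqu hrsm hrs).trans ?_
  gcongr
  exact hbound ys hysq hys

end Flat

section Fiber

open RingTheory.Sequence

universe v

theorem IsAssociatedPrime.exists_mem_iff_mul_mem {R : Type*} [CommRing R] [IsNoetherianRing R]
    {I Q : Ideal R} (hQ : IsAssociatedPrime Q (R ⧸ I)) : ∃ b, ∀ r, r ∈ Q ↔ r * b ∈ I := by
  obtain ⟨-, x, rfl⟩ := isAssociatedPrime_iff.mp hQ
  obtain ⟨b, rfl⟩ := Ideal.Quotient.mk_surjective x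
  refine ⟨b, fun r ↦ ?_⟩
  rw [Submodule.mem_colon_singleton, Submodule.mem_bot, ← Ideal.Quotient.eq_zero_iff_mem, map_mul]
  rfl

theorem Ideal.liesOver_of_flat_of_isAssociatedPrime {A B : Type*} [CommRing A] [CommRing B]
    [IsNoetherianRing B] [Algebra A B] [Module.Flat A B] (P : Ideal A) [P.IsPrime] (Q : Ideal B)
    (hQ : IsAssociatedPrime Q (B ⧸ P.map (algebraMap A B))) : Q.LiesOver P := by
  have := hQ.1
  obtain ⟨b, hb⟩ := hQ.exists_mem_iff_mul_mem
  refine ⟨le_antisymm (fun a ha ↦ ?_) (fun a ha ↦ ?_)⟩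
  · exact (hb _).mpr (Ideal.mul_mem_right _ _ (Ideal.mem_map_of_mem _ ha))
  · by_contra haP
    have hcolon (c : A) : c * a ∈ P ↔ c ∈ P :=
      ⟨fun h ↦ ((Ideal.IsPrime.mem_or_mem ‹_› h).resolve_right haP), fun h ↦ P.mul_mem_right _ h⟩
    have h := (hb _).mp (Ideal.mem_comap.mp ha)
    rw [mul_comm, Ideal.mul_algebraMap_mem_map_iff_of_flat hcolon, ← one_mul b, ← hb] at h
    exact (Ideal.ne_top_iff_one Q).mp (Ideal.IsPrime.ne_top ‹_›) h

theorem exists_length_le_localization_of_isAssociatedPrime {A B : Type v} [CommRing A] [CommRing B]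
    [IsNoetherianRing A] [IsNoetherianRing B] [Algebra A B] [Module.Flat A B] (P : Ideal A)
    [P.IsPrime] (Q : Ideal B) [Q.IsPrime]
    (hQ : IsAssociatedPrime Q (B ⧸ P.map (algebraMap A B))) :
    ∃ g : ℕ, (g : ℕ∞) ≤ P.height ∧ ∀ zs : List (Localization.AtPrime Q),
      (∀ z ∈ zs, z ∈ maximalIdeal _) → IsRegular (Localization.AtPrime Q) zs → zs.length ≤ g := by
  have := Ideal.liesOver_of_flat_of_isAssociatedPrime P Q hQ
  let := Localization.AtPrime.algebraOfLiesOver P Q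
  have : IsLocalHom (algebraMap (Localization.AtPrime P) (Localization.AtPrime Q)) := by
    rw [RingHom.algebraMap_toAlgebra]
    exact Localization.isLocalHom_localRingHom P Q (algebraMap A B) Ideal.LiesOver.over
  have hmap : (maximalIdeal (Localization.AtPrime P)).map
      (algebraMap (Localization.AtPrime P) (Localization.AtPrime Q)) =
      (P.map (algebraMap A B)).map (algebraMap B (Localization.AtPrime Q)) := by
    rw [← Localization.AtPrime.map_eq_maximalIdeal, Ideal.map_map, Ideal.map_map,
      ← IsScalarTower.algebraMap_eq, ← IsScalarTower.algebraMap_eq]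
  obtain ⟨b, hb⟩ := hQ.exists_mem_iff_mul_mem
  have hv : algebraMap B (Localization.AtPrime Q) b ∉
      (maximalIdeal (Localization.AtPrime P)).map
        (algebraMap (Localization.AtPrime P) (Localization.AtPrime Q)) := by
    rw [hmap, IsLocalization.algebraMap_mem_map_algebraMap_iff Q.primeCompl]
    rintro ⟨m, hm, hmb⟩
    exact hm ((hb m).mpr hmb)
  have hmv : ∀ r ∈ maximalIdeal (Localization.AtPrime Q),
      r * algebraMap B (Localization.AtPrime Q) b ∈ (maximalIdeal (Localization.AtPrime P)).map
        (algebraMap (Localization.AtPrime P) (Localization.AtPrime Q)) := by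
    intro r hr
    rw [hmap]
    rw [← Localization.AtPrime.map_eq_maximalIdeal] at hr
    refine Submodule.span_induction (p := fun r _ ↦ r * algebraMap B (Localization.AtPrime Q) b ∈
      (P.map (algebraMap A B)).map (algebraMap B (Localization.AtPrime Q))) ?_ ?_ ?_ ?_ hr
    · rintro _ ⟨q, hq, rfl⟩
      rw [← map_mul]
      exact Ideal.mem_map_of_mem _ ((hb q).mp hq)
    · simp
    · intro x y _ _ hx hy
      rw [add_mul]
      exact add_mem hx hy
    · intro c x _ hx
      rw [smul_eq_mul, mul_assoc]
      exact Ideal.mul_mem_left _ _ hx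
  obtain ⟨g, hg, h⟩ := exists_length_le_of_flat_of_isLocalHom hv hmv
  refine ⟨g, hg.trans ?_, h⟩
  rw [← WithBot.coe_le_coe, maximalIdeal_height_eq_ringKrullDim,
    IsLocalization.AtPrime.ringKrullDim_eq_height P]

theorem ringKrullDim_quotient_eq_height_map_maximalIdeal {R : Type*} [CommRing R] [IsLocalRing R]
    {I : Ideal R} (hI : I ≠ ⊤) :
    ringKrullDim (R ⧸ I) = ((maximalIdeal R).map (Ideal.Quotient.mk I)).height := by
  have : Nontrivial (R ⧸ I) := Ideal.Quotient.nontrivial_iff.mpr hI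
  have : IsLocalRing (R ⧸ I) := .of_surjective' _ Ideal.Quotient.mk_surjective
  have : IsLocalHom (Ideal.Quotient.mk I) := .of_surjective _ Ideal.Quotient.mk_surjective
  rw [map_maximalIdeal_of_surjective _ Ideal.Quotient.mk_surjective,
    maximalIdeal_height_eq_ringKrullDim]

theorem height_maximalIdeal_eq_of_map_eq {A B : Type*} [CommRing A] [CommRing B]
    [IsNoetherianRing A] [IsNoetherianRing B] [IsLocalRing A] [IsLocalRing B] [Algebra A B]
    [Module.Flat A B] [IsLocalHom (algebraMap A B)]
    (hAB : (maximalIdeal A).map (algebraMap A B) = maximalIdeal B) :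
    (maximalIdeal B).height = (maximalIdeal A).height := by
  have : (maximalIdeal B).LiesOver (maximalIdeal A) :=
    ⟨(((local_hom_TFAE (algebraMap A B)).out 0 4 rfl rfl).mp inferInstance).symm⟩
  rw [Ideal.height_eq_height_add_of_liesOver_of_hasGoingDown (maximalIdeal A) (maximalIdeal B),
    hAB, Ideal.map_quotient_self, Ideal.height_bot, add_zero]

theorem ringKrullDim_localization_quotient_map_le_one {A B : Type v} [CommRing A] [CommRing B]
    [IsNoetherianRing A] [IsNoetherianRing B] [IsLocalRing A] [IsLocalRing B] [Algebra A B]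
    [Module.Flat A B] [IsLocalHom (algebraMap A B)]
    (hAB : (maximalIdeal A).map (algebraMap A B) = maximalIdeal B)
    {rs : List A} (hrsm : ∀ r ∈ rs, r ∈ maximalIdeal A) (hrs : IsRegular A rs)
    (hdim : (maximalIdeal A).height ≤ 1 + rs.length) (P : Ideal A) [P.IsPrime]
    (Q : Ideal B) [Q.IsPrime] (hQ : IsAssociatedPrime Q (B ⧸ P.map (algebraMap A B))) :
    ringKrullDim (Localization.AtPrime Q ⧸
      (P.map (algebraMap A B)).map (algebraMap B (Localization.AtPrime Q))) ≤ 1 := by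
  have : Module.FaithfullyFlat A B := Module.FaithfullyFlat.of_flat_of_isLocalHom
  have := Ideal.liesOver_of_flat_of_isAssociatedPrime P Q hQ
  obtain ⟨g, hgP, hg⟩ := exists_length_le_localization_of_isAssociatedPrime P Q hQ
  let q : PrimeSpectrum B := ⟨Q, inferInstance⟩
  have hlen : (rs.length : ℕ∞) ≤ Order.coheight q + g := by
    rw [← rs.length_map (algebraMap A B)]
    refine length_le_coheight_add_of_localization q hg ?_ hrs.of_faithfullyFlat
    intro r hr
    obtain ⟨y, hy, rfl⟩ := List.mem_map.mp hr
    exact hAB ▸ Ideal.mem_map_of_mem _ (hrsm y hy)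
  have hQdim : Q.height + Order.coheight q ≤ (maximalIdeal A).height := by
    rw [← height_maximalIdeal_eq_of_map_eq hAB, ← WithBot.coe_le_coe,
      maximalIdeal_height_eq_ringKrullDim, ringKrullDim,
      Order.krullDim_eq_iSup_height_add_coheight_of_nonempty, WithBot.coe_le_coe,
      PrimeSpectrum.height_eq_orderHeight q]
    exact le_iSup (fun p : PrimeSpectrum B ↦ Order.height p + Order.coheight p) q
  have hover : (maximalIdeal (Localization.AtPrime Q)).LiesOver P :=
    .trans _ Q _
  have hfiber := Ideal.height_eq_height_add_of_liesOver_of_hasGoingDown P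
    (maximalIdeal (Localization.AtPrime Q))
  have hPQ : (P.map (algebraMap A B)).map (algebraMap B (Localization.AtPrime Q)) =
      P.map (algebraMap A (Localization.AtPrime Q)) := by
    rw [Ideal.map_map, ← IsScalarTower.algebraMap_eq]
  have hPQ' : P.map (algebraMap A (Localization.AtPrime Q)) ≠ ⊤ := fun h ↦
    (maximalIdeal.isMaximal (Localization.AtPrime Q)).ne_top
      (top_le_iff.mp (h ▸ Ideal.map_le_of_le_comap hover.over.le))
  have hQheight : (maximalIdeal (Localization.AtPrime Q)).height = Q.height := by
    rw [← WithBot.coe_inj, maximalIdeal_height_eq_ringKrullDim,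
      IsLocalization.AtPrime.ringKrullDim_eq_height Q]
  rw [hPQ, ringKrullDim_quotient_eq_height_map_maximalIdeal hPQ', ← WithBot.coe_one,
    WithBot.coe_le_coe]
  rw [← hQheight, hfiber] at hQdim
  have hfin : (maximalIdeal A).height ≠ ⊤ := Ideal.height_ne_top (maximalIdeal.isMaximal A).ne_top
  generalize ((maximalIdeal (Localization.AtPrime Q)).map (Ideal.Quotient.mk
    (P.map (algebraMap A (Localization.AtPrime Q))))).height = f at hQdim ⊢
  have hsum : f + (P.height + Order.coheight q) ≤ 1 + (P.height + Order.coheight q) :=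
    calc
      f + (P.height + Order.coheight q) = P.height + f + Order.coheight q := by ring
      _ ≤ 1 + rs.length := hQdim.trans hdim
      _ ≤ 1 + (Order.coheight q + P.height) := by gcongr; exact hlen.trans (by gcongr)
      _ = 1 + (P.height + Order.coheight q) := by rw [add_comm P.height]
  refine (ENat.add_le_add_iff_right (ne_top_of_le_ne_top hfin ?_)).mp hsum
  refine le_trans ?_ hQdim
  gcongr
  exact le_self_add

theorem exists_isRegular_length_eq_ringDepth (A : Type*) [CommRing A] [IsNoetherianRing A]
    [IsLocalRing A] : ∃ rs : List A, (rs.length : ℕ∞) = ringDepth A ∧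
      (∀ r ∈ rs, r ∈ maximalIdeal A) ∧ IsRegular A rs := by
  let s : Set ℕ∞ := {n | ∃ rs : List A, (rs.length : ℕ∞) = n ∧
    (∀ r ∈ rs, r ∈ maximalIdeal A) ∧ IsRegular A rs}
  have : Nonempty s := ⟨0, [], by simp, by simp, .nil A A⟩
  refine ENat.sSup_mem_of_nonempty_of_lt_top (s := s) (lt_of_le_of_lt (sSup_le ?_)
    (Ideal.height_ne_top (maximalIdeal.isMaximal A).ne_top).lt_top)
  rintro _ ⟨rs, rfl, -, hrs⟩
  exact hrs.length_le_height_maximalIdeal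

end Fiber

theorem almostCM_completion_fiber {A : Type*} [CommRing A] [IsNoetherianRing A] [IsLocalRing A]
    (hA : IsAlmostCM A) (P : Ideal A) [P.IsPrime]
    (Q : Ideal (AdicCompletion (maximalIdeal A) A)) [Q.IsPrime]
    (hQ : Q ∈ associatedPrimes (AdicCompletion (maximalIdeal A) A)
      (AdicCompletion (maximalIdeal A) A ⧸
        P.map (algebraMap A (AdicCompletion (maximalIdeal A) A)))) :
    IsAlmostCMWith
      (Localization.AtPrime Q ⧸
        (P.map (algebraMap A (AdicCompletion (maximalIdeal A) A))).map
          (algebraMap (AdicCompletion (maximalIdeal A) A) (Localization.AtPrime Q)))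
      ((maximalIdeal (Localization.AtPrime Q)).map
        (Ideal.Quotient.mk
          ((P.map (algebraMap A (AdicCompletion (maximalIdeal A) A))).map
            (algebraMap (AdicCompletion (maximalIdeal A) A) (Localization.AtPrime Q))))) := by
  obtain ⟨rs, hlen, hrsm, hrs⟩ := exists_isRegular_length_eq_ringDepth A
  rw [IsAlmostCM, ← maximalIdeal_height_eq_ringKrullDim, WithBot.coe_le_coe, ← hlen] at hA
  refine (ringKrullDim_localization_quotient_map_le_one AdicCompletion.maximalIdeal_eq_map.symm
    hrsm hrs hA P Q hQ).trans ?_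
  rw [← WithBot.coe_one, WithBot.coe_le_coe]
  exact le_self_add
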